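/- The Salzmann operation ∗ on ℝ is commutative: x ∗ y = y ∗ x for all x, y ∈ ℝ. -/

import Mathlib

/-- The Salzmann operation on `ℝ`:
`x * t = x + t/2` if `x/t ≤ -3/2` or `x/t ≥ 1`,
`x * t = x/2 + t` if `-2/3 ≤ x/t ≤ 1`,
`x * t = 2x + 2t` if `-3/2 ≤ x/t ≤ -2/3`, and `x * 0 = x`.
(The clauses agree on the overlaps of the regions, so the nested `if`
below defines exactly this operation.) -/
noncomputable def salz (x t : ℝ) : ℝ :=
  if t = 0 then x
  else if x / t ≤ -(3 / 2) ∨ 1 ≤ x / t then x + t / 2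
  else if -(2 / 3) ≤ x / t then x / 2 + t
  else 2 * x + 2 * t

/-- the Salzmann operation is commutative. -/
theorem stmt_11 : ∀ x y : ℝ, salz x y = salz y x := by
  intro x y
  unfold salz
  rcases lt_trichotomy x 0 with hx | rfl | hx
  · rcases lt_trichotomy y 0 with hy | rfl | hy
    · simp only [hx.ne, hy.ne, if_false, div_le_iff_of_neg hx, div_le_iff_of_neg hy,
        le_div_iff_of_neg hx, le_div_iff_of_neg hy]
      grind
    · norm_num [hx.ne]
    · simp only [hx.ne, hy.ne', if_false, div_le_iff_of_neg hx, div_le_iff₀ hy,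
        le_div_iff_of_neg hx, le_div_iff₀ hy]
      grind
  · by_cases hy : y = 0 <;> norm_num [hy]
  · rcases lt_trichotomy y 0 with hy | rfl | hy
    · simp only [hx.ne', hy.ne, if_false, div_le_iff₀ hx, div_le_iff_of_neg hy,
        le_div_iff₀ hx, le_div_iff_of_neg hy]
      grind
    · norm_num [hx.ne']
    · simp only [hx.ne', hy.ne', if_false, div_le_iff₀ hx, div_le_iff₀ hy,
        le_div_iff₀ hx, le_div_iff₀ hy]
      grind
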